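/- arXiv:0710.1950 — 2 statements merged into one kernel-verified Lean document; each statement's English description precedes it below -/
import Mathlib

section
/- Let h > 0, β > 0, μ > 0, and let e : ℝ → ℝ be continuously differentiable with e(x) = e(h) e^{−μ(x−h)} for x > h and e(x) = e(−h) e^{μ(x+h)} for x < −h. Let f ∈ L²(ℝ²) vanish almost everywhere outside a compact set, and define u(x,z) = ∫_{ℝ²} ( e^{iβ|z−ζ|} / (2iβ) ) e(x) e(ξ) f(ξ,ζ) dξ dζ. Let Q_R = { (x,z) : |x| ≤ R, |z| ≤ R } and let ν denote the outward unit normal on ∂Q_R. Then ∫₀^∞ ∫_{∂Q_R} | ∂u/∂ν − iβ u |² dℓ dR < +∞, where dℓ is one-dimensional Hausdorff measure on the boundary of the square ∂Q_R. -/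
open MeasureTheory Set Complex
open scoped ENNReal NNReal

noncomputable section

/-- Partial derivative in the first variable of a complex-valued function on `ℝ × ℝ`. -/
def pdx (u : ℝ × ℝ → ℂ) (p : ℝ × ℝ) : ℂ := deriv (fun t => u (t, p.2)) p.1

/-- Partial derivative in the second variable of a complex-valued function on `ℝ × ℝ`. -/
def pdz (u : ℝ × ℝ → ℂ) (p : ℝ × ℝ) : ℂ := deriv (fun t => u (p.1, t)) p.2

/-- Derivative along the outward unit normal of the square `Q_R = [-R,R]²`:
`±∂/∂x` on the vertical sides, `±∂/∂z` on the horizontal sides. -/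
def sqNormalDeriv (R : ℝ) (u : ℝ × ℝ → ℂ) (p : ℝ × ℝ) : ℂ :=
  if |p.1| = R then ((Real.sign p.1 : ℝ) : ℂ) * pdx u p
  else ((Real.sign p.2 : ℝ) : ℂ) * pdz u p

/-- The square `Q_R = {(x,z) : |x| ≤ R, |z| ≤ R}`. -/
def sqQ (R : ℝ) : Set (ℝ × ℝ) := {p : ℝ × ℝ | |p.1| ≤ R ∧ |p.2| ≤ R}

lemma aux_e_bound (h μ : ℝ) (hμ : 0 < μ)
    (e : ℝ → ℝ) (he_C1 : ContDiff ℝ 1 e)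
    (he_plus : ∀ x : ℝ, h < x → e x = e h * Real.exp (-μ * (x - h)))
    (he_minus : ∀ x : ℝ, x < -h → e x = e (-h) * Real.exp (μ * (x + h))) :
    ∃ A : ℝ, 0 ≤ A ∧ ∀ x, |e x| ≤ A * Real.exp (-μ * |x|) ∧
      |deriv e x| ≤ A * Real.exp (-μ * |x|) := by
  have c1 : Continuous fun x => e x * Real.exp (μ * |x|) := by
    have := he_C1.continuous
    fun_prop
  have c2 : Continuous fun x => deriv e x * Real.exp (μ * |x|) := by
    have := he_C1.continuous_deriv le_rfl
    fun_prop
  obtain ⟨B1, hB1⟩ := (isCompact_Icc (a := -|h|) (b := |h|)).exists_bound_of_continuousOn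
    c1.continuousOn
  obtain ⟨B2, hB2⟩ := (isCompact_Icc (a := -|h|) (b := |h|)).exists_bound_of_continuousOn
    c2.continuousOn
  set P := |e h| * Real.exp (μ * h) with hP
  set N := |e (-h)| * Real.exp (μ * h) with hN
  have hP0 : 0 ≤ P := by positivity
  have hN0 : 0 ≤ N := by positivity
  refine ⟨|B1| + |B2| + (1 + μ) * P + (1 + μ) * N, by positivity, fun x => ?_⟩
  set A := |B1| + |B2| + (1 + μ) * P + (1 + μ) * N with hA
  have a1 := abs_nonneg B1
  have a2 := abs_nonneg B2
  have m1 : 0 ≤ μ * P := by positivity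
  have m2 : 0 ≤ μ * N := by positivity
  have key : ∀ y B : ℝ, B ≤ A → |y * Real.exp (μ * |x|)| ≤ B →
      |y| ≤ A * Real.exp (-μ * |x|) := by
    intro y B hB hy
    rw [abs_mul, Real.abs_exp] at hy
    rw [neg_mul, Real.exp_neg, ← div_eq_mul_inv, le_div_iff₀ (Real.exp_pos _)]
    linarith
  by_cases hx : x ∈ Icc (-|h|) |h|
  · exact ⟨key _ B1 (by linarith [le_abs_self B1]) (hB1 x hx),
      key _ B2 (by linarith [le_abs_self B2]) (hB2 x hx)⟩
  · have hx' : |h| < |x| := by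
      by_contra hc
      exact hx (abs_le.mp (not_lt.mp hc))
    rcases le_total 0 x with h0 | h0
    · have hxa : |x| = x := abs_of_nonneg h0
      have hxh : h < x := by linarith [le_abs_self h]
      have ev : e =ᶠ[nhds x] fun t => e h * Real.exp (-μ * (t - h)) := by
        filter_upwards [lt_mem_nhds hxh] with t ht using he_plus t ht
      have hd : HasDerivAt (fun t => e h * Real.exp (-μ * (t - h)))
          (e h * (Real.exp (-μ * (x - h)) * (-μ * 1))) x :=
        ((((hasDerivAt_id x).sub_const h).const_mul (-μ)).exp).const_mul (e h)
      have hexp : Real.exp (-μ * (x - h)) * Real.exp (μ * x) = Real.exp (μ * h) := by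
        rw [← Real.exp_add]; ring_nf
      constructor
      · refine key _ P (by linarith) ?_
        rw [he_plus x hxh, hxa, mul_assoc, hexp, abs_mul, Real.abs_exp]
      · refine key _ (μ * P) (by linarith) ?_
        rw [ev.deriv_eq, hd.deriv, hxa]
        have : e h * (Real.exp (-μ * (x - h)) * (-μ * 1)) * Real.exp (μ * x)
          = -(μ * (e h * Real.exp (μ * h))) := by rw [← hexp]; ring
        rw [this, abs_neg, abs_mul, abs_mul, Real.abs_exp, abs_of_pos hμ]
    · have hxa : |x| = -x := abs_of_nonpos h0
      have hxh : x < -h := by linarith [le_abs_self h]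
      have ev : e =ᶠ[nhds x] fun t => e (-h) * Real.exp (μ * (t + h)) := by
        filter_upwards [gt_mem_nhds hxh] with t ht using he_minus t ht
      have hd : HasDerivAt (fun t => e (-h) * Real.exp (μ * (t + h)))
          (e (-h) * (Real.exp (μ * (x + h)) * (μ * 1))) x :=
        ((((hasDerivAt_id x).add_const h).const_mul (μ)).exp).const_mul (e (-h))
      have hexp : Real.exp (μ * (x + h)) * Real.exp (μ * -x) = Real.exp (μ * h) := by
        rw [← Real.exp_add]; ring_nf
      constructor
      · refine key _ N (by linarith) ?_
        rw [he_minus x hxh, hxa, mul_assoc, hexp, abs_mul, Real.abs_exp]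
      · refine key _ (μ * N) (by linarith) ?_
        rw [ev.deriv_eq, hd.deriv, hxa]
        have : e (-h) * (Real.exp (μ * (x + h)) * (μ * 1)) * Real.exp (μ * -x)
          = (μ * (e (-h) * Real.exp (μ * h))) := by rw [← hexp]; ring
        rw [this, abs_mul, abs_mul, Real.abs_exp, abs_of_pos hμ]

lemma aux_frontier (R : ℝ) (hR : 0 < R) :
    frontier (sqQ R) = Metric.sphere (0 : ℝ × ℝ) R := by
  have : sqQ R = Metric.closedBall (0 : ℝ × ℝ) R := by
    ext p
    simp [sqQ, Prod.norm_def]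
  rw [this, frontier_closedBall _ hR.ne']

lemma aux_mem (R : ℝ) (p : ℝ × ℝ) (hp : p ∈ Metric.sphere (0 : ℝ × ℝ) R) :
    |p.1| ≤ R ∧ |p.2| ≤ R ∧ (|p.1| = R ∨ |p.2| = R) := by
  rw [mem_sphere_zero_iff_norm, Prod.norm_def, Real.norm_eq_abs, Real.norm_eq_abs] at hp
  refine ⟨hp ▸ le_max_left _ _, hp ▸ le_max_right _ _, ?_⟩
  rcases max_choice |p.1| |p.2| with hc | hc
  · left; rw [← hp, hc]
  · right; rw [← hp, hc]

lemma aux_meas (R : ℝ) (hR : 0 < R) :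
    Measure.hausdorffMeasure 1 (Metric.sphere (0 : ℝ × ℝ) R) ≤ ENNReal.ofReal (8 * R) := by
  have i1 : ∀ a : ℝ, Isometry (fun t : ℝ => (a, t)) := fun a =>
    Isometry.of_dist_eq fun x y => by simp [Prod.dist_eq]
  have i2 : ∀ a : ℝ, Isometry (fun t : ℝ => (t, a)) := fun a =>
    Isometry.of_dist_eq fun x y => by simp [Prod.dist_eq]
  have v1 : ∀ a : ℝ, Measure.hausdorffMeasure 1 ((fun t : ℝ => (a, t)) '' Icc (-R) R)
      = ENNReal.ofReal (2 * R) := fun a => by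
    rw [(i1 a).hausdorffMeasure_image (Or.inl zero_le_one), hausdorffMeasure_real,
      Real.volume_Icc]
    ring_nf
  have v2 : ∀ a : ℝ, Measure.hausdorffMeasure 1 ((fun t : ℝ => (t, a)) '' Icc (-R) R)
      = ENNReal.ofReal (2 * R) := fun a => by
    rw [(i2 a).hausdorffMeasure_image (Or.inl zero_le_one), hausdorffMeasure_real,
      Real.volume_Icc]
    ring_nf
  have sub : Metric.sphere (0 : ℝ × ℝ) R ⊆
      (((fun t : ℝ => (R, t)) '' Icc (-R) R) ∪ ((fun t : ℝ => (-R, t)) '' Icc (-R) R)) ∪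
      (((fun t : ℝ => (t, R)) '' Icc (-R) R) ∪ ((fun t : ℝ => (t, -R)) '' Icc (-R) R)) := by
    intro p hp
    obtain ⟨h1, h2, h3⟩ := aux_mem R p hp
    rcases h3 with h3 | h3
    · left
      rcases (abs_eq hR.le).mp h3 with h4 | h4
      · left; exact ⟨p.2, abs_le.mp h2, by rw [← h4]⟩
      · right; exact ⟨p.2, abs_le.mp h2, by rw [← h4]⟩
    · right
      rcases (abs_eq hR.le).mp h3 with h4 | h4
      · left; exact ⟨p.1, abs_le.mp h1, by simp [← h4]⟩
      · right; exact ⟨p.1, abs_le.mp h1, by simp [← h4]⟩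
  refine (measure_mono sub).trans ((measure_union_le _ _).trans
    ((add_le_add (measure_union_le _ _) (measure_union_le _ _)).trans ?_))
  rw [v1, v1, v2, v2, ← ENNReal.ofReal_add (by positivity) (by positivity),
    ← ENNReal.ofReal_add (by positivity) (by positivity)]
  apply ENNReal.ofReal_le_ofReal
  linarith

def auxG (β : ℝ) (F : ℝ × ℝ → ℂ) (z : ℝ) : ℂ :=
  ∫ w : ℝ × ℝ, Complex.exp (Complex.I * (β : ℂ) * ((|z - w.2| : ℝ) : ℂ)) * F w

lemma aux_norm_exp (β t : ℝ) : ‖Complex.exp (Complex.I * (β : ℂ) * (t : ℂ))‖ = 1 := by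
  have := Complex.norm_exp_I_mul_ofReal (β * t)
  rwa [Complex.ofReal_mul, ← mul_assoc] at this

lemma aux_exp_lip (β s t : ℝ) (hβ : 0 < β) :
    ‖Complex.exp (Complex.I * (β : ℂ) * (s : ℂ)) - Complex.exp (Complex.I * (β : ℂ) * (t : ℂ))‖
      ≤ β * |s - t| := by
  have e1 : Complex.exp (Complex.I * (β : ℂ) * (s : ℂ)) - Complex.exp (Complex.I * (β : ℂ) * (t : ℂ))
    = Complex.exp (Complex.I * (β : ℂ) * (t : ℂ)) *
      (Complex.exp (Complex.I * ((β * (s - t) : ℝ) : ℂ)) - 1) := by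
    rw [mul_sub, ← Complex.exp_add, mul_one]
    congr 2
    push_cast
    ring
  rw [e1, norm_mul, aux_norm_exp, one_mul]
  refine Real.norm_exp_I_mul_ofReal_sub_one_le.trans ?_
  rw [Real.norm_eq_abs, abs_mul, abs_of_pos hβ]

lemma aux_int (β : ℝ) (F : ℝ × ℝ → ℂ) (hF : Integrable F) (z : ℝ) :
    Integrable fun w : ℝ × ℝ =>
      Complex.exp (Complex.I * (β : ℂ) * ((|z - w.2| : ℝ) : ℂ)) * F w := by
  refine hF.bdd_mul (c := 1) ?_ (Filter.Eventually.of_forall fun w => (aux_norm_exp _ _).le)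
  apply Continuous.aestronglyMeasurable
  fun_prop

lemma auxG_bound (β : ℝ) (F : ℝ × ℝ → ℂ) (z : ℝ) :
    ‖auxG β F z‖ ≤ ∫ w, ‖F w‖ := by
  refine (norm_integral_le_integral_norm _).trans (le_of_eq ?_)
  simp only [norm_mul, aux_norm_exp, one_mul]

lemma auxG_deriv (β : ℝ) (hβ : 0 < β) (F : ℝ × ℝ → ℂ) (hF : Integrable F) (z : ℝ) :
    ‖deriv (auxG β F) z‖ ≤ β * ∫ w, ‖F w‖ := by
  refine norm_deriv_le_of_lip' (by positivity) (Filter.Eventually.of_forall fun y => ?_)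
  unfold auxG
  rw [← integral_sub (aux_int β F hF y) (aux_int β F hF z)]
  calc _ ≤ ∫ w, (β * ‖y - z‖) * ‖F w‖ := by
        refine norm_integral_le_of_norm_le (hF.norm.const_mul _)
          (Filter.Eventually.of_forall fun w => ?_)
        rw [← sub_mul, norm_mul]
        refine mul_le_mul_of_nonneg_right ((aux_exp_lip β _ _ hβ).trans ?_) (norm_nonneg _)
        refine mul_le_mul_of_nonneg_left ((abs_abs_sub_abs_le _ _).trans (le_of_eq ?_)) hβ.le
        rw [Real.norm_eq_abs]; congr 1; ring
    _ = _ := by rw [integral_const_mul]; ring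

lemma auxG_rad (β M : ℝ) (F : ℝ × ℝ → ℂ) (hM : 0 ≤ M)
    (hs : ∀ᵐ w : ℝ × ℝ, M < |w.2| → F w = 0) (z : ℝ) (hz : M < |z|) :
    ((Real.sign z : ℝ) : ℂ) * deriv (auxG β F) z = Complex.I * (β : ℂ) * auxG β F z := by
  have main : ∀ σ : ℝ, σ * σ = 1 → (∀ᶠ t in nhds z, ∀ y : ℝ, |y| ≤ M → |t - y| = σ * (t - y)) →
      (σ : ℂ) * deriv (auxG β F) z = Complex.I * (β : ℂ) * auxG β F z := by
    intro σ hσ hev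
    set C : ℂ := ∫ w : ℝ × ℝ, Complex.exp (-(Complex.I * (β : ℂ) * ((σ * w.2 : ℝ) : ℂ))) * F w
    have ev : auxG β F =ᶠ[nhds z] fun t : ℝ => Complex.exp (Complex.I * (β : ℂ) * σ * t) * C := by
      filter_upwards [hev] with t ht
      unfold auxG
      rw [← integral_const_mul]
      apply integral_congr_ae
      filter_upwards [hs] with w hw
      by_cases hwM : M < |w.2|
      · simp [hw hwM]
      · rw [ht _ (not_lt.mp hwM), ← mul_assoc, ← Complex.exp_add]
        congr 2
        push_cast
        ring
    have hd : HasDerivAt (fun t : ℝ => Complex.exp (Complex.I * (β : ℂ) * σ * t) * C)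
        (Complex.exp (Complex.I * (β : ℂ) * σ * z) * (Complex.I * (β : ℂ) * σ * 1) * C) z :=
      ((((hasDerivAt_id z).ofReal_comp).const_mul (Complex.I * (β : ℂ) * σ)).cexp).mul_const C
    rw [ev.deriv_eq, hd.deriv, ev.self_of_nhds]
    have : (σ : ℂ) * σ = 1 := by exact_mod_cast hσ
    linear_combination (Complex.exp (Complex.I * (β : ℂ) * σ * z) * (Complex.I * (β : ℂ)) * C) * this
  rcases lt_or_ge 0 z with h0 | h0
  · rw [Real.sign_of_pos h0]
    rw [abs_of_pos h0] at hz
    refine main 1 (by norm_num) ?_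
    filter_upwards [lt_mem_nhds hz] with t ht y hy
    rw [one_mul, abs_of_nonneg]
    linarith [le_abs_self y]
  · rw [abs_of_nonpos h0] at hz
    rw [Real.sign_of_neg (by linarith)]
    refine main (-1) (by norm_num) ?_
    filter_upwards [gt_mem_nhds (show z < -M by linarith)] with t ht y hy
    rw [abs_of_nonpos]
    · ring
    · linarith [neg_abs_le y]

lemma aux_sign (x : ℝ) : ‖((Real.sign x : ℝ) : ℂ)‖ ≤ 1 := by
  rw [Complex.norm_real]
  rcases Real.sign_apply_eq x with h | h | h <;> simp [h]

lemma aux_fin (D c : ℝ) (hc : 0 < c) :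
    ∫⁻ R in Set.Ioi (0 : ℝ), ENNReal.ofReal (D * (R * Real.exp (-c * R))) < ⊤ := by
  have := integrableOn_rpow_mul_exp_neg_mul_rpow (p := 1) (s := 1) (b := c) (by norm_num)
    (by norm_num) hc
  simp only [Real.rpow_one] at this
  exact (this.const_mul D).lintegral_lt_top

/-- **Theorem (the guided component satisfies the radiation condition on squares).**
Let `e` be a `C¹` transverse profile decaying exponentially at rate `μ` outside
`|x| ≤ h`, let `f ∈ L²(ℝ²)` vanish a.e. outside a compact set, and let
`u(x,z) = ∫ (e^{iβ|z-ζ|}/(2iβ)) e(x) e(ξ) f(ξ,ζ) dξ dζ`.  Then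
`∫₀^∞ ∫_{∂Q_R} |∂u/∂ν - iβu|² dℓ dR < ∞`. -/
theorem guided_component_radiation_condition_on_squares
    (h β μ : ℝ) (hh : 0 < h) (hβ : 0 < β) (hμ : 0 < μ)
    (e : ℝ → ℝ) (he_C1 : ContDiff ℝ 1 e)
    (he_plus : ∀ x : ℝ, h < x → e x = e h * Real.exp (-μ * (x - h)))
    (he_minus : ∀ x : ℝ, x < -h → e x = e (-h) * Real.exp (μ * (x + h)))
    (f : ℝ × ℝ → ℂ) (hf : MemLp f 2 (volume : Measure (ℝ × ℝ)))
    (hf_supp : ∃ K : Set (ℝ × ℝ), IsCompact K ∧ ∀ᵐ w : ℝ × ℝ, w ∉ K → f w = 0)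
    (u : ℝ × ℝ → ℂ)
    (hu : ∀ p : ℝ × ℝ, u p = ∫ w : ℝ × ℝ,
      Complex.exp (Complex.I * (β : ℂ) * ((|p.2 - w.2| : ℝ) : ℂ)) /
          (2 * Complex.I * (β : ℂ)) * ((e p.1 : ℝ) : ℂ) * ((e w.1 : ℝ) : ℂ) * f w) :
    (∫⁻ R in Set.Ioi (0 : ℝ), ∫⁻ p in frontier (sqQ R),
        (‖sqNormalDeriv R u p - Complex.I * (β : ℂ) * u p‖₊ : ℝ≥0∞) ^ 2
        ∂(MeasureTheory.Measure.hausdorffMeasure 1)) < ⊤ := by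
  obtain ⟨A, hA0, hA⟩ := aux_e_bound h μ hμ e he_C1 he_plus he_minus
  obtain ⟨K, hK, hfK⟩ := hf_supp
  obtain ⟨M, hM0, hKM⟩ := hK.isBounded.subset_closedBall_lt 0 (0 : ℝ × ℝ)
  have hfi : Integrable f := by
    have : IntegrableOn f K := by
      haveI : IsFiniteMeasure ((volume : Measure (ℝ × ℝ)).restrict K) :=
        ⟨by rw [Measure.restrict_apply_univ]; exact hK.measure_lt_top⟩
      exact (hf.restrict K).integrable one_le_two
    exact this.integrable_of_ae_notMem_eq_zero hfK
  set F : ℝ × ℝ → ℂ := fun w => (((e w.1 : ℝ) : ℂ) / (2 * Complex.I * (β : ℂ))) * f w with hFdef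
  have hF : Integrable F := by
    refine hfi.bdd_mul (c := A / ‖2 * Complex.I * (β : ℂ)‖) ?_
      (Filter.Eventually.of_forall fun w => ?_)
    · apply Continuous.aestronglyMeasurable
      have := he_C1.continuous
      fun_prop
    · rw [norm_div, Complex.norm_real, Real.norm_eq_abs]
      gcongr
      refine (hA w.1).1.trans (mul_le_of_le_one_right hA0 (Real.exp_le_one_iff.mpr ?_))
      have : 0 ≤ μ * |w.1| := by positivity
      linarith
  have hs : ∀ᵐ w : ℝ × ℝ, M < |w.2| → F w = 0 := by
    filter_upwards [hfK] with w hw hwM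
    have : w ∉ K := fun hwK => by
      have h1 := hKM hwK
      rw [mem_closedBall_zero_iff] at h1
      have h2 := norm_snd_le w
      rw [Real.norm_eq_abs] at h2
      linarith
    simp [hFdef, hw this]
  set g := auxG β F with hg
  have hug : ∀ p : ℝ × ℝ, u p = ((e p.1 : ℝ) : ℂ) * g p.2 := by
    intro p
    rw [hu p, hg, auxG, ← integral_const_mul]
    congr 1
    ext w
    simp only [hFdef]
    ring
  set N := ∫ w, ‖F w‖ with hN
  have hN0 : 0 ≤ N := integral_nonneg fun w => norm_nonneg _
  have hgb : ∀ z, ‖g z‖ ≤ N := auxG_bound β F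
  have hgd : ∀ z, ‖deriv g z‖ ≤ β * N := auxG_deriv β hβ F hF
  have hpdx : ∀ p, pdx u p = ((deriv e p.1 : ℝ) : ℂ) * g p.2 := by
    intro p
    unfold pdx
    simp only [hug]
    exact (((he_C1.differentiable one_ne_zero p.1).hasDerivAt.ofReal_comp).mul_const _).deriv
  have hpdz : ∀ p, pdz u p = ((e p.1 : ℝ) : ℂ) * deriv g p.2 := by
    intro p
    unfold pdz
    simp only [hug]
    exact deriv_const_mul_field _
  set B := A * N * (1 + 2 * β) * Real.exp (μ * M) with hB
  have hexpM : 1 ≤ Real.exp (μ * M) := Real.one_le_exp (by positivity)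
  have hB0 : 0 ≤ B := by positivity
  have key : ∀ R : ℝ, 0 < R → ∀ p ∈ Metric.sphere (0 : ℝ × ℝ) R,
      ‖sqNormalDeriv R u p - Complex.I * (β : ℂ) * u p‖ ≤ B * Real.exp (-μ * R) := by
    intro R hR p hp
    obtain ⟨h1, h2, h3⟩ := aux_mem R p hp
    have hIu : ‖Complex.I * (β : ℂ) * u p‖ ≤ β * (A * Real.exp (-μ * |p.1|) * N) := by
      rw [hug, norm_mul, norm_mul, norm_mul, Complex.norm_I, one_mul, Complex.norm_real,
        Complex.norm_real, Real.norm_eq_abs, Real.norm_eq_abs, abs_of_pos hβ]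
      gcongr
      · exact (hA p.1).1
      · exact hgb _
    unfold sqNormalDeriv
    split_ifs with hc
    · have hx : ‖((Real.sign p.1 : ℝ) : ℂ) * pdx u p‖ ≤ A * Real.exp (-μ * |p.1|) * N := by
        rw [norm_mul, hpdx, norm_mul, Complex.norm_real (deriv e p.1), Real.norm_eq_abs]
        refine (mul_le_of_le_one_left (by positivity) (aux_sign _)).trans ?_
        gcongr
        · exact (hA p.1).2
        · exact hgb _
      refine (norm_sub_le _ _).trans ((add_le_add hx hIu).trans ?_)
      rw [hc]
      have : A * N * (1 + 2 * β) * 1 ≤ B := by rw [hB]; gcongr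
      have h5 : A * N * (1 + β) ≤ B := by
        have : 0 ≤ A * N * β := by positivity
        linarith
      have h6 := mul_le_mul_of_nonneg_right h5 (Real.exp_pos (-μ * R)).le
      linarith
    · have h4 : |p.2| = R := h3.resolve_left hc
      by_cases hRM : M < R
      · have := auxG_rad β M F hM0.le hs p.2 (by rw [h4]; exact hRM)
        rw [← hg] at this
        have h0 : ((Real.sign p.2 : ℝ) : ℂ) * pdz u p - Complex.I * (β : ℂ) * u p = 0 := by
          rw [hpdz, hug]
          linear_combination ((e p.1 : ℝ) : ℂ) * this
        rw [h0, norm_zero]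
        positivity
      · have hle : Real.exp (-μ * |p.1|) ≤ 1 := by
          refine Real.exp_le_one_iff.mpr ?_
          have : 0 ≤ μ * |p.1| := by positivity
          linarith
        have hz : ‖((Real.sign p.2 : ℝ) : ℂ) * pdz u p‖ ≤
            A * Real.exp (-μ * |p.1|) * (β * N) := by
          rw [norm_mul, hpdz, norm_mul, Complex.norm_real (e p.1), Real.norm_eq_abs]
          refine (mul_le_of_le_one_left (by positivity) (aux_sign _)).trans ?_
          gcongr
          · exact (hA p.1).1
          · exact hgd _
        refine (norm_sub_le _ _).trans ((add_le_add hz hIu).trans ?_)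
        have h5 : 1 ≤ Real.exp (μ * M) * Real.exp (-μ * R) := by
          rw [← Real.exp_add]
          apply Real.one_le_exp
          have := mul_le_mul_of_nonneg_left (not_lt.mp hRM) hμ.le
          linarith
        calc _ = A * N * (2 * β) * Real.exp (-μ * |p.1|) := by ring
          _ ≤ A * N * (1 + 2 * β) * (Real.exp (μ * M) * Real.exp (-μ * R)) := by
            gcongr
            · linarith
            · linarith
          _ = _ := by rw [hB]; ring
  refine lt_of_le_of_lt ?_ (aux_fin (8 * B ^ 2) (2 * μ) (by positivity))
  refine setLIntegral_mono' measurableSet_Ioi fun R hR => ?_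
  have hR : 0 < R := hR
  rw [aux_frontier R hR]
  calc _ ≤ ∫⁻ p in Metric.sphere (0 : ℝ × ℝ) R, (ENNReal.ofReal (B * Real.exp (-μ * R))) ^ 2
          ∂(MeasureTheory.Measure.hausdorffMeasure 1) := by
        refine setLIntegral_mono' Metric.isClosed_sphere.measurableSet fun p hp => ?_
        refine pow_le_pow_left' ?_ 2
        have := ENNReal.ofReal_le_ofReal (key R hR p hp)
        rwa [ofReal_norm_eq_enorm] at this
    _ = (ENNReal.ofReal (B * Real.exp (-μ * R))) ^ 2 *
          Measure.hausdorffMeasure 1 (Metric.sphere (0 : ℝ × ℝ) R) := setLIntegral_const _ _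
    _ ≤ (ENNReal.ofReal (B * Real.exp (-μ * R))) ^ 2 * ENNReal.ofReal (8 * R) := by
        gcongr
        exact aux_meas R hR
    _ = _ := by
        rw [← ENNReal.ofReal_pow (by positivity), ← ENNReal.ofReal_mul (by positivity)]
        congr 1
        rw [mul_pow, ← Real.exp_nat_mul,
          show ((2 : ℕ) : ℝ) * (-μ * R) = -(2 * μ) * R by push_cast; ring]
        ring
end
end

section
/- Let K > 0, β > 0, R > 0, y₀ > 0, and let G : [0, y₀] → ℂ be measurable with |G(y)| ≤ K for all y ∈ [0, y₀]. Then | 4 ∫₀^{y₀} y² e^{−β R y²} G(y) / √(y² − 2i) dy | ≤ K √( π / (2 β³) ) · R^{−3/2}, where √(y² − 2i) denotes the principal square root. -/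
open MeasureTheory Set Complex
open scoped ENNReal NNReal Real

noncomputable section

lemma aux_gauss (a : ℝ) (ha : 0 < a) :
    IntegrableOn (fun y : ℝ => y ^ 2 * Real.exp (-a * y ^ 2)) (Ioi 0) ∧
    ∫ y in Ioi (0:ℝ), y ^ 2 * Real.exp (-a * y ^ 2) = a ^ (-(3:ℝ)/2) * (√π / 4) := by
  constructor
  · have h := integrableOn_rpow_mul_exp_neg_mul_sq ha (s := 2) (by norm_num)
    simpa only [Real.rpow_two] using h
  · have h := _root_.integral_rpow_mul_exp_neg_mul_rpow (p := 2) (q := 2) (by norm_num) (by norm_num) ha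
    simp only [Real.rpow_two] at h
    rw [h]
    have hg : Real.Gamma ((2 + 1) / 2) = √π / 2 := by
      rw [show ((2:ℝ) + 1) / 2 = 1/2 + 1 by norm_num, Real.Gamma_add_one (by norm_num),
        Real.Gamma_one_half_eq]
      ring
    rw [hg, show (-(2 + 1) / 2 : ℝ) = -3/2 by norm_num]
    ring

lemma aux_den (y : ℝ) : √2 ≤ ‖((y : ℂ) ^ 2 - 2 * Complex.I) ^ ((1 : ℂ) / 2)‖ := by
  have h : ((1:ℂ)/2) = ((1/2 : ℝ) : ℂ) := by push_cast; rfl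
  rw [h, Complex.norm_cpow_real, ← Real.sqrt_eq_rpow]
  apply Real.sqrt_le_sqrt
  have := Complex.abs_im_le_norm ((y : ℂ) ^ 2 - 2 * Complex.I)
  have h2 : ((y : ℂ) ^ 2 - 2 * Complex.I).im = -2 := by
    rw [← Complex.ofReal_pow]; simp [-Complex.ofReal_pow]
  rw [h2] at this
  norm_num at this
  exact this

/-- **Steepest-descent estimate.**  If `G : [0,y₀] → ℂ` is measurable with `|G| ≤ K`,
then for `β, R > 0`:
`|4 ∫₀^{y₀} y² e^{-βRy²} G(y)/√(y²-2i) dy| ≤ K √(π/(2β³)) R^{-3/2}`,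
where `√(y²-2i)` is the principal square root. -/
theorem steepest_descent_saddle_estimate
    (K β R y₀ : ℝ) (hK : 0 < K) (hβ : 0 < β) (hR : 0 < R) (hy₀ : 0 < y₀)
    (G : ℝ → ℂ) (hG_meas : Measurable G)
    (hG_bdd : ∀ y ∈ Set.Icc (0 : ℝ) y₀, ‖G y‖ ≤ K) :
    ‖(4 : ℂ) * ∫ y in (0 : ℝ)..y₀,
        ((y : ℂ) ^ 2 * ((Real.exp (-β * R * y ^ 2) : ℝ) : ℂ) * G y) /
          (((y : ℂ) ^ 2 - 2 * Complex.I) ^ ((1 : ℂ) / 2))‖ ≤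
      K * Real.sqrt (Real.pi / (2 * β ^ 3)) * R ^ (-(3 : ℝ) / 2) := by
  have ha : 0 < β * R := mul_pos hβ hR
  obtain ⟨hi, hv⟩ := aux_gauss (β * R) ha
  have hs2 : 0 < √(2:ℝ) := by positivity
  have hi' : IntegrableOn (fun y : ℝ => y ^ 2 * Real.exp (-(β * R) * y ^ 2)) (Ioc 0 y₀) :=
    hi.mono_set Ioc_subset_Ioi_self
  have h1 : ‖∫ y in (0 : ℝ)..y₀,
        ((y : ℂ) ^ 2 * ((Real.exp (-β * R * y ^ 2) : ℝ) : ℂ) * G y) /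
          (((y : ℂ) ^ 2 - 2 * Complex.I) ^ ((1 : ℂ) / 2))‖ ≤
      ∫ y in (0 : ℝ)..y₀, (K / √2) * (y ^ 2 * Real.exp (-(β * R) * y ^ 2)) := by
    apply intervalIntegral.norm_integral_le_of_norm_le hy₀.le
    · refine Filter.Eventually.of_forall fun y hy => ?_
      have hd := aux_den y
      have hG := hG_bdd y ⟨hy.1.le, hy.2⟩
      rw [norm_div, norm_mul, norm_mul, norm_pow, Complex.norm_real, Complex.norm_real,
        Real.norm_eq_abs, Real.norm_eq_abs, sq_abs, Real.abs_exp]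
      calc _ ≤ (y ^ 2 * Real.exp (-β * R * y ^ 2) * K) / √2 := by gcongr
        _ = _ := by
          rw [show -β * R = -(β * R) by ring]; ring
    · exact (intervalIntegrable_iff_integrableOn_Ioc_of_le hy₀.le).2 (hi'.const_mul _)
  have h2 : ∫ y in (0 : ℝ)..y₀, (K / √2) * (y ^ 2 * Real.exp (-(β * R) * y ^ 2)) ≤
      (K / √2) * ((β * R) ^ (-(3:ℝ)/2) * (√π / 4)) := by
    rw [intervalIntegral.integral_const_mul, ← hv, intervalIntegral.integral_of_le hy₀.le]
    refine mul_le_mul_of_nonneg_left ?_ (by positivity)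
    exact setIntegral_mono_set hi (Filter.Eventually.of_forall fun y => by positivity)
      (Ioc_subset_Ioi_self : Ioc 0 y₀ ⊆ Ioi 0).eventuallyLE
  have h3 : √(π / (2 * β ^ 3)) = √π / √2 * β ^ (-(3:ℝ)/2) := by
    rw [Real.sqrt_div Real.pi_pos.le, Real.sqrt_mul (by norm_num), Real.sqrt_eq_rpow (β ^ 3),
      ← Real.rpow_natCast, ← Real.rpow_mul hβ.le,
      show (-(3:ℝ)/2) = -(((3:ℕ):ℝ) * (1/2)) by norm_num, Real.rpow_neg hβ.le]
    field_simp
  rw [norm_mul, h3]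
  have h4 : ‖(4:ℂ)‖ = 4 := by simp
  rw [h4]
  calc _ ≤ 4 * ((K / √2) * ((β * R) ^ (-(3:ℝ)/2) * (√π / 4))) := by
        gcongr; exact h1.trans h2
    _ = _ := by
        rw [Real.mul_rpow hβ.le hR.le]; ring
end
end
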